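/- Assume the DVV hypothesis stated in the context. Then for all integers g ≥ 0, n ≥ 0 with 2g+n ≥ 3 and all w_0, w_1, …, w_n > 0: ∂_{w_0}Ω_{g,n+1}(w_0,w_1,…,w_n) = w_0^{5/2}·[∂_x∂_y Ω_{g−1,n+2}(x,y,w_1,…,w_n)]|_{x=y=w_0} + w_0^{5/2}·Σ_{g_1+g_2=g, A_1⊔A_2=[n], 2g_1−1+|A_1|>0, 2g_2−1+|A_2|>0} ∂_{w_0}Ω_{g_1,|A_1|+1}(w_0,w_{A_1})·∂_{w_0}Ω_{g_2,|A_2|+1}(w_0,w_{A_2}) + w_0^{−3/2}·Σ_{i=1}^{n} 𝒟_{w_0,w_i}[ x ↦ ∂_xΩ_{g,n}(x, w_{[n]∖{i}}) ]. -/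

import Mathlib

open Finset

/-- Real value of the double factorial `k‼` of an integer (with `k‼ = 1` for `k ≤ 0`,
in particular `(-1)‼ = 1`). -/
noncomputable def dfac (k : ℤ) : ℝ := (Nat.doubleFactorial k.toNat : ℝ)

/-- The rescaled correlator `⟨τ̃_{a_1} ⋯ τ̃_{a_n}⟩_g` with `τ̃_a = (2a+1)!! τ_a`. -/
noncomputable def ttau (τ : ℤ → (n : ℕ) → (Fin n → ℤ) → ℝ) (g : ℤ) (n : ℕ)
    (a : Fin n → ℤ) : ℝ :=
  (∏ i, dfac (2 * a i + 1)) * τ g n a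

/-- The DVV hypothesis: a symmetric family of correlators `⟨τ_{a_1} ⋯ τ_{a_n}⟩_g`,
vanishing unless `2g-2+n > 0`, all indices are nonnegative and `∑ aᵢ = 3g-3+n`
(in particular vanishing for `g < 0`), satisfying the Dijkgraaf–Verlinde–Verlinde
(Virasoro) recursion relations. -/
structure DVVFamily (τ : ℤ → (n : ℕ) → (Fin n → ℤ) → ℝ) : Prop where
  symm : ∀ (g : ℤ) (n : ℕ) (a : Fin n → ℤ) (σ : Equiv.Perm (Fin n)), τ g n (a ∘ σ) = τ g n a
  vanish : ∀ (g : ℤ) (n : ℕ) (a : Fin n → ℤ),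
      ¬((∀ i, 0 ≤ a i) ∧ 0 < 2 * g - 2 + (n : ℤ) ∧ (∑ i, a i) = 3 * g - 3 + n) → τ g n a = 0
  dvv : ∀ (g : ℤ) (n : ℕ), 0 ≤ g → 3 ≤ 2 * g + (n : ℤ) → ∀ (a₀ : ℤ) (a : Fin n → ℤ),
      0 ≤ a₀ → (∀ i, 0 ≤ a i) →
      ttau τ g (n + 1) (Fin.cons a₀ a) =
        (∑ i, (2 * (a i : ℝ) + 1) * ttau τ g n (Function.update a i (a₀ + a i - 1)))
        + (1 / 2) * ∑ b₁ ∈ Finset.Icc (0 : ℤ) (a₀ - 2),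
            (ttau τ (g - 1) (n + 2) (Fin.cons b₁ (Fin.cons (a₀ - 2 - b₁) a))
             + ∑ g₁ ∈ Finset.Icc (0 : ℤ) g, ∑ A ∈ (univ : Finset (Fin n)).powerset,
                if 0 < 2 * g₁ - 1 + (A.card : ℤ) ∧ 0 < 2 * (g - g₁) - 1 + ((Aᶜ).card : ℤ) then
                  ttau τ g₁ (A.card + 1) (Fin.cons b₁ (fun j => a (A.orderIsoOfFin rfl j).1))
                  * ttau τ (g - g₁) ((Aᶜ).card + 1)
                      (Fin.cons (a₀ - 2 - b₁) (fun j => a ((Aᶜ).orderIsoOfFin rfl j).1))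
                else 0)

/-- The antiderivative generating function
`Ω_{g,n}(w_1,…,w_n) = ∑ ⟨τ_{a_1}⋯τ_{a_n}⟩_g ∏ (2aᵢ-1)!! wᵢ^{aᵢ+1/2}` (with `(-1)!! = 1`),
written as a finite sum over `0 ≤ aᵢ ≤ 3g-3+n`. -/
noncomputable def OmegaF (τ : ℤ → (n : ℕ) → (Fin n → ℤ) → ℝ) (g : ℤ) (n : ℕ)
    (w : Fin n → ℝ) : ℝ :=
  ∑ a : Fin n → Fin ((3 * g + n - 3).toNat + 1),
    τ g n (fun i => ((a i : ℕ) : ℤ))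
      * ∏ i, dfac (2 * ((a i : ℕ) : ℤ) - 1) * w i ^ (((a i : ℕ) : ℝ) + 1 / 2)

/-- Removing the `i`-th entry from a tuple `(w_1, …, w_n)`. -/
def removeIdx {n : ℕ} (w : Fin n → ℝ) (i : Fin n) (j : Fin (n - 1)) : ℝ :=
  if (j : ℕ) < (i : ℕ) then w ⟨j, by have := j.2; omega⟩
  else w ⟨(j : ℕ) + 1, by have := j.2; omega⟩

/-- Formal representation of `∂ₓ Ω_{g,m+1}(x, w_1, …, w_m)` as an element of `ℝ[X]`,
where the monomial `X^a` stands for the half-integer power `x^{a-1/2}`. -/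
noncomputable def dOmegaPoly (τ : ℤ → (n : ℕ) → (Fin n → ℤ) → ℝ) (g : ℤ) (m : ℕ)
    (w : Fin m → ℝ) : Polynomial ℝ :=
  ∑ a : Fin (m + 1) → Fin ((3 * g + (m + 1) - 3).toNat + 1),
    Polynomial.C ((((a 0 : ℕ) : ℝ) + 1 / 2)
        * τ g (m + 1) (fun i => ((a i : ℕ) : ℤ))
        * (∏ i, dfac (2 * ((a i : ℕ) : ℤ) - 1))
        * ∏ j : Fin m, w j ^ (((a j.succ : ℕ) : ℝ) + 1 / 2))
      * Polynomial.X ^ (a 0 : ℕ)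

/-- The linear operator `𝒟_{u,v}` on finite linear combinations of the functions
`x^{a-1/2}` (represented by polynomials via `X^a ↔ x^{a-1/2}`), determined by
`𝒟_{u,v} x^{a-1/2} = u v^{1/2} (u^{a+1} + u^a v + ⋯ + v^{a+1})`. -/
noncomputable def Dcal (u v : ℝ) (p : Polynomial ℝ) : ℝ :=
  ∑ m ∈ p.support, p.coeff m *
    (u * v ^ ((1 : ℝ) / 2) * ∑ k ∈ Finset.range (m + 2), u ^ (m + 1 - k) * v ^ k)

/-- The half-integer power `x^{a+1/2}/(2a+1)`. -/
noncomputable def halfPow (a : ℕ) (x : ℝ) : ℝ := x ^ ((a : ℝ) + 1 / 2) / (2 * a + 1)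

/-- The derivative `x^{a-1/2}/2` of `halfPow a`. -/
noncomputable def halfPowDeriv (a : ℕ) (x : ℝ) : ℝ := x ^ ((a : ℝ) - 1 / 2) / 2

lemma hasDerivAt_halfPow (a : ℕ) {x : ℝ} (hx : 0 < x) :
    HasDerivAt (halfPow a) (halfPowDeriv a x) x := by
  have h := (Real.hasDerivAt_rpow_const (x := x) (p := (a : ℝ) + 1 / 2)
    (Or.inl hx.ne')).div_const (2 * (a : ℝ) + 1)
  refine h.congr_deriv ?_
  have h2 : (2 * (a : ℝ) + 1) ≠ 0 := by positivity
  have h3 : (a : ℝ) + 1 / 2 - 1 = a - 1 / 2 := by ring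
  rw [halfPowDeriv, h3]
  field_simp

lemma halfPowDeriv_eq (a : ℕ) {x : ℝ} (hx : 0 < x) :
    halfPowDeriv a x = x ^ (-(1 : ℝ) / 2) / 2 * x ^ a := by
  rw [halfPowDeriv, show (a : ℝ) - 1 / 2 = -1 / 2 + a by ring, Real.rpow_add hx,
    Real.rpow_natCast]
  ring

lemma mul_halfPow_eq (a : ℕ) {x : ℝ} (hx : 0 < x) :
    (2 * (a : ℝ) + 1) * halfPow a x = x ^ ((1 : ℝ) / 2) * x ^ a := by
  have h2 : (2 * (a : ℝ) + 1) ≠ 0 := by positivity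
  rw [halfPow, add_comm (a : ℝ), Real.rpow_add hx, Real.rpow_natCast]
  field_simp

lemma deriv_sum_mul_halfPow {ι : Type*} (s : Finset ι) (c : ι → ℝ) (k : ι → ℕ) {x : ℝ}
    (hx : 0 < x) :
    deriv (fun t => ∑ i ∈ s, c i * halfPow (k i) t) x = ∑ i ∈ s, c i * halfPowDeriv (k i) x :=
  (HasDerivAt.fun_sum fun i _ => (hasDerivAt_halfPow (k i) hx).const_mul (c i)).deriv

lemma dfac_two_mul_add_one (a : ℕ) :
    dfac (2 * (a : ℤ) + 1) = (2 * (a : ℝ) + 1) * dfac (2 * (a : ℤ) - 1) := by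
  cases a with
  | zero => simp [dfac]
  | succ a =>
    have h1 : (2 * ((a + 1 : ℕ) : ℤ) + 1).toNat = (2 * a + 1) + 2 := by omega
    have h2 : (2 * ((a + 1 : ℕ) : ℤ) - 1).toNat = 2 * a + 1 := by omega
    rw [dfac, dfac, h1, h2, Nat.doubleFactorial]
    push_cast
    ring

lemma ttau_natCast (τ : ℤ → (n : ℕ) → (Fin n → ℤ) → ℝ) (g : ℤ) {n : ℕ} (a : Fin n → ℕ) :
    ttau τ g n (fun i => (a i : ℤ)) =
      (∏ i, (2 * (a i : ℝ) + 1)) * (∏ i, dfac (2 * (a i : ℤ) - 1)) * τ g n (fun i => a i) := by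
  rw [ttau, ← Finset.prod_mul_distrib]
  simp_rw [dfac_two_mul_add_one]

lemma sum_fin_pi_extend {n M N : ℕ} (hMN : M ≤ N) (F : (Fin n → ℕ) → ℝ)
    (hF : ∀ a, F a ≠ 0 → ∀ i, a i < M) :
    ∑ a : Fin n → Fin M, F (fun i => a i) = ∑ a : Fin n → Fin N, F (fun i => a i) := by
  refine Finset.sum_of_injOn (fun a i => Fin.castLE hMN (a i)) ?_ (by simp) ?_ (by simp)
  · intro a _ b _ hab
    funext i
    simpa using congrFun hab i
  · intro a _ ha
    by_contra h0
    have h1 := hF _ h0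
    exact ha ⟨fun i => ⟨a i, h1 i⟩, by simp, by ext i; simp⟩

lemma sum_fin_cons {n N : ℕ} (F : (Fin (n + 1) → Fin N) → ℝ) :
    ∑ a, F a = ∑ k : Fin N, ∑ a : Fin n → Fin N, F (Fin.cons k a) := by
  rw [← Fintype.sum_prod_type']
  exact (Fintype.sum_equiv (Fin.consEquiv fun _ => Fin N) _ _ fun _ => rfl).symm

lemma sum_fin_insertNth {n N : ℕ} (i : Fin (n + 1)) (F : (Fin (n + 1) → Fin N) → ℝ) :
    ∑ a, F a = ∑ k : Fin N, ∑ a : Fin n → Fin N, F (i.insertNth k a) := by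
  rw [← Fintype.sum_prod_type']
  exact (Fintype.sum_equiv (Fin.insertNthEquiv (fun _ => Fin N) i) _ _ fun _ => rfl).symm

lemma ttau_ne_zero_imp {τ : ℤ → (n : ℕ) → (Fin n → ℤ) → ℝ} (h : DVVFamily τ) {g : ℤ} {n : ℕ}
    {a : Fin n → ℤ} (ha : ttau τ g n a ≠ 0) :
    (∀ i, 0 ≤ a i) ∧ 0 < 2 * g - 2 + (n : ℤ) ∧ (∑ i, a i) = 3 * g - 3 + n := by
  by_contra hc
  exact ha (by rw [ttau, h.vanish g n a hc, mul_zero])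

lemma ttau_ne_zero_imp_lt {τ : ℤ → (n : ℕ) → (Fin n → ℤ) → ℝ} (h : DVVFamily τ) {g : ℤ} {n : ℕ}
    {a : Fin n → ℕ} (ha : ttau τ g n (fun i => (a i : ℤ)) ≠ 0) (i : Fin n) :
    a i < (3 * g + n - 3).toNat + 1 := by
  obtain ⟨h1, -, h2⟩ := ttau_ne_zero_imp h ha
  have := Finset.single_le_sum (f := fun i => (a i : ℤ)) (fun j _ => h1 j) (mem_univ i)
  omega

lemma ttau_comp_perm {τ : ℤ → (n : ℕ) → (Fin n → ℤ) → ℝ} (h : DVVFamily τ) (g : ℤ) {n : ℕ}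
    (a : Fin n → ℤ) (σ : Equiv.Perm (Fin n)) : ttau τ g n (a ∘ σ) = ttau τ g n a := by
  rw [ttau, ttau, h.symm]
  congr 1
  exact Equiv.prod_comp σ fun i => dfac (2 * a i + 1)

lemma ttau_insertNth {τ : ℤ → (n : ℕ) → (Fin n → ℤ) → ℝ} (h : DVVFamily τ) (g : ℤ) {n : ℕ}
    (i : Fin (n + 1)) (c : ℤ) (b : Fin n → ℤ) :
    ttau τ g (n + 1) (i.insertNth c b : Fin (n + 1) → ℤ) = ttau τ g (n + 1) (Fin.cons c b) := by
  rw [← ttau_comp_perm h g (Fin.cons c b) i.cycleRange, Fin.cons_comp_cycleRange]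

lemma OmegaF_eq {τ : ℤ → (n : ℕ) → (Fin n → ℤ) → ℝ} (h : DVVFamily τ) {g : ℤ} {n N : ℕ}
    (hN : (3 * g + n - 3).toNat + 1 ≤ N) (w : Fin n → ℝ) :
    OmegaF τ g n w = ∑ a : Fin n → Fin N, ttau τ g n (fun i => ((a i : ℕ) : ℤ)) *
      ∏ i, halfPow (a i) (w i) := by
  rw [← sum_fin_pi_extend hN
    (fun a => ttau τ g n (fun i => (a i : ℤ)) * ∏ i, halfPow (a i) (w i))
    fun a ha => ttau_ne_zero_imp_lt h (left_ne_zero_of_mul ha), OmegaF]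
  refine Finset.sum_congr rfl fun a _ => ?_
  rw [ttau_natCast τ g (fun i => (a i : ℕ))]
  have h0 : ∏ i, (2 * ((a i : ℕ) : ℝ) + 1) ≠ 0 :=
    Finset.prod_ne_zero_iff.mpr fun i _ => by positivity
  simp only [halfPow, Finset.prod_div_distrib, Finset.prod_mul_distrib]
  rw [mul_assoc, mul_assoc, mul_comm, ← mul_assoc, mul_div_assoc', mul_div_assoc', eq_div_iff h0]
  ring

lemma natCast_cons {n N : ℕ} (k : Fin N) (a : Fin n → Fin N) :
    (fun i => (((Fin.cons k a : Fin (n + 1) → Fin N) i : ℕ) : ℤ)) =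
      (Fin.cons ((k : ℕ) : ℤ) (fun i => ((a i : ℕ) : ℤ)) : Fin (n + 1) → ℤ) := by
  ext i
  refine Fin.cases ?_ (fun j => ?_) i <;> simp

lemma OmegaF_cons_eq {τ : ℤ → (n : ℕ) → (Fin n → ℤ) → ℝ} (h : DVVFamily τ) {g : ℤ} {n N : ℕ}
    (hN : (3 * g + (n + 1 : ℕ) - 3).toNat + 1 ≤ N) (x : ℝ) (w : Fin n → ℝ) :
    OmegaF τ g (n + 1) (Fin.cons x w) = ∑ k : Fin N, (∑ a : Fin n → Fin N,
      ttau τ g (n + 1) (Fin.cons ((k : ℕ) : ℤ) fun i => ((a i : ℕ) : ℤ)) *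
        ∏ i, halfPow (a i) (w i)) * halfPow k x := by
  rw [OmegaF_eq h hN, sum_fin_cons]
  simp_rw [natCast_cons, Fin.prod_univ_succ, Fin.cons_zero, Fin.cons_succ, Finset.sum_mul]
  refine Finset.sum_congr rfl fun k _ => Finset.sum_congr rfl fun a _ => ?_
  ring

lemma deriv_OmegaF_cons {τ : ℤ → (n : ℕ) → (Fin n → ℤ) → ℝ} (h : DVVFamily τ) {g : ℤ} {n N : ℕ}
    (hN : (3 * g + (n + 1 : ℕ) - 3).toNat + 1 ≤ N) {x : ℝ} (hx : 0 < x) (w : Fin n → ℝ) :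
    deriv (fun t => OmegaF τ g (n + 1) (Fin.cons t w)) x = ∑ k : Fin N,
      (∑ a : Fin n → Fin N,
        ttau τ g (n + 1) (Fin.cons ((k : ℕ) : ℤ) fun i => ((a i : ℕ) : ℤ)) *
          ∏ i, halfPow (a i) (w i)) * halfPowDeriv k x := by
  simp_rw [OmegaF_cons_eq h hN]
  exact deriv_sum_mul_halfPow _ _ _ hx

lemma deriv_deriv_OmegaF_cons {τ : ℤ → (n : ℕ) → (Fin n → ℤ) → ℝ} (h : DVVFamily τ) {g : ℤ}
    {n N : ℕ} (hN : (3 * g + (n + 2 : ℕ) - 3).toNat + 1 ≤ N) {u : ℝ} (hu : 0 < u)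
    (w : Fin n → ℝ) :
    deriv (fun x => deriv (fun y => OmegaF τ g (n + 2) (Fin.cons x (Fin.cons y w))) u) u =
      ∑ k : Fin N, (∑ l : Fin N, (∑ a : Fin n → Fin N,
        ttau τ g (n + 2)
          (Fin.cons ((k : ℕ) : ℤ) (Fin.cons ((l : ℕ) : ℤ) fun i => ((a i : ℕ) : ℤ))) *
          ∏ i, halfPow (a i) (w i)) * halfPowDeriv l u) * halfPowDeriv k u := by
  have key : ∀ x y, OmegaF τ g (n + 2) (Fin.cons x (Fin.cons y w)) =
      ∑ l : Fin N, (∑ k : Fin N, (∑ a : Fin n → Fin N,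
        ttau τ g (n + 2)
          (Fin.cons ((k : ℕ) : ℤ) (Fin.cons ((l : ℕ) : ℤ) fun i => ((a i : ℕ) : ℤ))) *
          ∏ i, halfPow (a i) (w i)) * halfPow k x) * halfPow l y := by
    intro x y
    rw [OmegaF_cons_eq h hN]
    simp_rw [Finset.sum_mul]
    conv_rhs => rw [Finset.sum_comm]
    refine Finset.sum_congr rfl fun k _ => ?_
    rw [sum_fin_cons]
    refine Finset.sum_congr rfl fun l _ => Finset.sum_congr rfl fun a _ => ?_
    rw [natCast_cons, Fin.prod_univ_succ]
    simp only [Fin.cons_zero, Fin.cons_succ]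
    ring
  simp_rw [key, fun c : Fin N → ℝ => deriv_sum_mul_halfPow univ c (fun l => (l : ℕ)) hu]
  have swap : ∀ (c : Fin N → Fin N → ℝ) (p q : Fin N → ℝ),
      ∑ l, (∑ k, c k l * p k) * q l = ∑ k, (∑ l, c k l * q l) * p k := by
    intro c p q
    simp_rw [Finset.sum_mul]
    rw [Finset.sum_comm]
    refine Finset.sum_congr rfl fun k _ => Finset.sum_congr rfl fun l _ => ?_
    ring
  refine Eq.trans (congrArg (deriv · u) (funext fun x => swap _ _ _)) ?_
  exact deriv_sum_mul_halfPow _ _ _ hu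

lemma sum_fin_mul_split {n N : ℕ} (A : Finset (Fin n)) (F : (Fin A.card → Fin N) → ℝ)
    (G : (Fin Aᶜ.card → Fin N) → ℝ) :
    ∑ a : Fin n → Fin N, F (fun j => a (A.orderIsoOfFin rfl j).1) *
        G (fun j => a (Aᶜ.orderIsoOfFin rfl j).1) = (∑ b, F b) * ∑ c, G c := by
  rw [Finset.sum_mul_sum, ← Fintype.sum_prod_type']
  refine Fintype.sum_equiv (((finSumEquivOfFinset (s := A) rfl rfl).symm.arrowCongr
    (Equiv.refl (Fin N))).trans (Equiv.sumArrowEquivProdArrow _ _ _)) _ _ fun a => ?_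
  congr 2

lemma prod_split {n : ℕ} (A : Finset (Fin n)) (f : Fin n → ℝ) :
    ∏ i, f i = (∏ j : Fin A.card, f (A.orderIsoOfFin rfl j).1) *
      ∏ j : Fin Aᶜ.card, f (Aᶜ.orderIsoOfFin rfl j).1 := by
  rw [← Fintype.prod_equiv (finSumEquivOfFinset (s := A) rfl rfl) (fun x => f _) f fun _ => rfl,
    Fintype.prod_sum_type]
  rfl

lemma Dcal_sum {ι : Type*} (u v : ℝ) (s : Finset ι) (c : ι → ℝ) (k : ι → ℕ) :
    Dcal u v (∑ i ∈ s, Polynomial.C (c i) * Polynomial.X ^ k i) =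
      ∑ i ∈ s, c i * (u * v ^ ((1 : ℝ) / 2) *
        ∑ j ∈ Finset.range (k i + 2), u ^ (k i + 1 - j) * v ^ j) := by
  let L : Polynomial ℝ →ₗ[ℝ] ℝ := Polynomial.lsum fun m =>
    LinearMap.mulRight ℝ (u * v ^ ((1 : ℝ) / 2) *
      ∑ k ∈ Finset.range (m + 2), u ^ (m + 1 - k) * v ^ k)
  have hL : ∀ p, Dcal u v p = L p := fun p => rfl
  rw [hL, map_sum]
  refine Finset.sum_congr rfl fun i _ => ?_
  simp [L, Polynomial.lsum_apply, Polynomial.C_mul_X_pow_eq_monomial, Polynomial.sum_monomial_index, mul_assoc]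

lemma Dcal_dOmegaPoly {τ : ℤ → (n : ℕ) → (Fin n → ℤ) → ℝ} (h : DVVFamily τ) {g : ℤ} {m N : ℕ}
    (hN : (3 * g + (m + 1 : ℕ) - 3).toNat + 1 ≤ N) (u v : ℝ) (w : Fin m → ℝ) :
    Dcal u v (dOmegaPoly τ g m w) = ∑ c : Fin N, ∑ b : Fin m → Fin N,
      ttau τ g (m + 1) (Fin.cons ((c : ℕ) : ℤ) fun i => ((b i : ℕ) : ℤ)) / 2 *
        (∏ j, halfPow (b j) (w j)) * (u * v ^ ((1 : ℝ) / 2) *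
          ∑ k ∈ Finset.range (c + 2), u ^ ((c : ℕ) + 1 - k) * v ^ k) := by
  have e1 : ∑ c : Fin N, ∑ b : Fin m → Fin N,
      ttau τ g (m + 1) (Fin.cons ((c : ℕ) : ℤ) fun i => ((b i : ℕ) : ℤ)) / 2 *
        (∏ j, halfPow (b j) (w j)) * (u * v ^ ((1 : ℝ) / 2) *
          ∑ k ∈ Finset.range (c + 2), u ^ ((c : ℕ) + 1 - k) * v ^ k) =
      ∑ a : Fin (m + 1) → Fin N,
        ttau τ g (m + 1) (fun i => ((a i : ℕ) : ℤ)) / 2 *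
        (∏ j : Fin m, halfPow (a j.succ) (w j)) * (u * v ^ ((1 : ℝ) / 2) *
          ∑ k ∈ Finset.range ((a 0 : ℕ) + 2), u ^ ((a 0 : ℕ) + 1 - k) * v ^ k) := by
    rw [sum_fin_cons]
    refine Finset.sum_congr rfl fun c _ => Finset.sum_congr rfl fun b _ => ?_
    rw [natCast_cons]
    simp only [Fin.cons_zero, Fin.cons_succ]
  rw [e1, ← sum_fin_pi_extend hN (fun a =>
    ttau τ g (m + 1) (fun i => (a i : ℤ)) / 2 *
        (∏ j : Fin m, halfPow (a j.succ) (w j)) * (u * v ^ ((1 : ℝ) / 2) *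
          ∑ k ∈ Finset.range ((a 0 : ℕ) + 2), u ^ ((a 0 : ℕ) + 1 - k) * v ^ k)), dOmegaPoly]
  · rw [Dcal_sum]
    refine Finset.sum_congr rfl fun a _ => ?_
    congr 1
    rw [ttau_natCast τ g (fun i => (a i : ℕ)),
      Fin.prod_univ_succ fun i => 2 * ((a i : ℕ) : ℝ) + 1]
    have h0 : ∏ i : Fin m, (2 * ((a i.succ : ℕ) : ℝ) + 1) ≠ 0 :=
      Finset.prod_ne_zero_iff.mpr fun i _ => by positivity
    simp only [halfPow, Finset.prod_div_distrib]
    rw [mul_div_assoc', eq_div_iff h0]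
    ring
  · intro a ha
    refine ttau_ne_zero_imp_lt h fun h0 => ha ?_
    simp [h0]

/-- Regrouping by `c = a₀ + k - 1` the joint contribution of the first index and of one other. -/
lemma sum_join {N : ℕ} (G : ℤ → ℝ) (hneg : G (-1) = 0) (hG : ∀ c : ℕ, N ≤ c + 1 → G c = 0)
    {u v : ℝ} (hu : 0 < u) (hv : 0 < v) :
    ∑ a₀ : Fin N, ∑ k : Fin N, (2 * ((k : ℕ) : ℝ) + 1) * G ((a₀ : ℕ) + (k : ℕ) - 1) *
        (halfPow k v * halfPowDeriv a₀ u) =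
      u ^ (-(3 : ℝ) / 2) * ∑ c : Fin N, G (c : ℕ) / 2 * (u * v ^ ((1 : ℝ) / 2) *
        ∑ k ∈ Finset.range (c + 2), u ^ ((c : ℕ) + 1 - k) * v ^ k) := by
  have hu1 : u ^ (-(1 : ℝ) / 2) = u ^ (-(3 : ℝ) / 2) * u := by
    rw [← Real.rpow_add_one hu.ne']; norm_num
  have e1 : ∀ a₀ k : Fin N, (2 * ((k : ℕ) : ℝ) + 1) * G ((a₀ : ℕ) + (k : ℕ) - 1) *
        (halfPow k v * halfPowDeriv a₀ u) = u ^ (-(3 : ℝ) / 2) * u * v ^ ((1 : ℝ) / 2) / 2 *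
        (G ((a₀ : ℕ) + (k : ℕ) - 1) * (u ^ (a₀ : ℕ) * v ^ (k : ℕ))) := by
    intro a₀ k
    rw [halfPowDeriv_eq _ hu, ← hu1]
    linear_combination (u ^ (-(1 : ℝ) / 2) / 2 * u ^ (a₀ : ℕ) * G ((a₀ : ℕ) + (k : ℕ) - 1)) *
      mul_halfPow_eq k hv
  have e2 : ∑ c : Fin N, G (c : ℕ) / 2 * (u * v ^ ((1 : ℝ) / 2) *
        ∑ k ∈ Finset.range (c + 2), u ^ ((c : ℕ) + 1 - k) * v ^ k) =
      u * v ^ ((1 : ℝ) / 2) / 2 * ∑ c : Fin N,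
        ∑ k ∈ Finset.range (c + 2), G (c : ℕ) * (u ^ ((c : ℕ) + 1 - k) * v ^ k) := by
    rw [Finset.mul_sum]
    refine Finset.sum_congr rfl fun c _ => ?_
    rw [← Finset.mul_sum]
    ring
  simp_rw [e1, ← Finset.mul_sum]
  rw [e2]
  have e3 : ∑ a₀ : Fin N, ∑ k : Fin N,
        G ((a₀ : ℕ) + (k : ℕ) - 1) * (u ^ (a₀ : ℕ) * v ^ (k : ℕ)) =
      ∑ c : Fin N, ∑ k ∈ Finset.range (c + 2), G (c : ℕ) * (u ^ ((c : ℕ) + 1 - k) * v ^ k) := by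
    simp_rw [fun a : ℕ => Fin.sum_univ_eq_sum_range
      (fun k => G ((a : ℤ) + (k : ℕ) - 1) * (u ^ (a : ℕ) * v ^ k)) N]
    rw [Fin.sum_univ_eq_sum_range
      (fun a => ∑ k ∈ range N, G ((a : ℤ) + (k : ℕ) - 1) * (u ^ (a : ℕ) * v ^ k)) N,
      Fin.sum_univ_eq_sum_range (fun c => ∑ k ∈ Finset.range (c + 2),
        G (c : ℕ) * (u ^ ((c : ℕ) + 1 - k) * v ^ k)) N]
    rw [← Finset.sum_product', Finset.sum_sigma']
    refine Finset.sum_bij_ne_zero (fun p _ _ => ⟨p.1 + p.2 - 1, p.2⟩) ?_ ?_ ?_ ?_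
    · rintro ⟨a, k⟩ hp h0
      have hG0 := left_ne_zero_of_mul h0
      have h1 : a + k ≠ 0 := by
        intro h2
        apply hG0
        rw [← hneg]
        congr 1
        simp only
        omega
      have h3 : ¬ N ≤ (a + k - 1) + 1 := fun h4 => hG0 (by
        rw [← hG _ h4]
        congr 1
        simp only
        omega)
      simp only [mem_sigma, mem_range]
      omega
    · rintro ⟨a, k⟩ hp h0 ⟨a', k'⟩ hp' h0' heq
      have key : ∀ a k : ℕ, G ((a : ℤ) + k - 1) * (u ^ a * v ^ k) ≠ 0 → a + k ≠ 0 := by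
        intro a k h0 h2
        apply left_ne_zero_of_mul h0
        rw [← hneg]
        congr 1
        omega
      have h1 := key _ _ h0
      have h2 := key _ _ h0'
      simp only [Sigma.mk.injEq, heq_eq_eq] at heq
      simp only [Prod.mk.injEq]
      omega
    · rintro ⟨c, k⟩ hp h0
      simp only [mem_sigma, mem_range] at hp
      have h1 : ¬ N ≤ c + 1 := fun h2 => left_ne_zero_of_mul h0 (hG c h2)
      have h3 : ((c + 1 - k : ℕ) : ℤ) + k - 1 = c := by omega
      refine ⟨(c + 1 - k, k), ?_, ?_, ?_⟩
      · simp only [mem_product, mem_range]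
        omega
      · simpa only [h3] using h0
      · simp only [Sigma.mk.injEq, heq_eq_eq, and_true]
        omega
    · rintro ⟨a, k⟩ hp h0
      have h1 : a + k ≠ 0 := by
        intro h2
        apply left_ne_zero_of_mul h0
        rw [← hneg]
        congr 1
        simp only
        omega
      have h3 : ((a + k - 1 : ℕ) : ℤ) = (a : ℤ) + k - 1 := by omega
      have h4 : a + k - 1 + 1 - k = a := by omega
      simp only [h3, h4]
  rw [e3]
  ring

/-- Splitting the first index `a₀ = b₁ + b₂ + 2`. -/
lemma sum_split {N : ℕ} (H : ℤ → ℤ → ℝ) (hH : ∀ b c : ℕ, N ≤ b + c + 2 → H b c = 0)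
    {u : ℝ} (hu : 0 < u) :
    ∑ a₀ : Fin N, (1 / 2 * ∑ b ∈ Finset.Icc (0 : ℤ) ((a₀ : ℕ) - 2), H b ((a₀ : ℕ) - 2 - b)) *
        halfPowDeriv a₀ u =
      u ^ ((5 : ℝ) / 2) * ∑ b : Fin N, ∑ c : Fin N,
        H (b : ℕ) (c : ℕ) * (halfPowDeriv b u * halfPowDeriv c u) := by
  have hd : ∀ b c : ℕ, 1 / 2 * halfPowDeriv (b + c + 2) u =
      u ^ ((5 : ℝ) / 2) * (halfPowDeriv b u * halfPowDeriv c u) := by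
    intro b c
    have h1 : u ^ ((b + c + 2 : ℕ) - (1 : ℝ) / 2) =
        u ^ ((5 : ℝ) / 2) * (u ^ ((b : ℝ) - 1 / 2) * u ^ ((c : ℝ) - 1 / 2)) := by
      rw [← Real.rpow_add hu, ← Real.rpow_add hu]
      congr 1
      push_cast
      ring
    rw [halfPowDeriv, h1, halfPowDeriv, halfPowDeriv]
    ring
  simp_rw [Finset.mul_sum, Finset.sum_mul]
  rw [Finset.sum_sigma', Finset.sum_sigma']
  symm
  refine Finset.sum_bij_ne_zero (fun (p : (_ : Fin N) × Fin N) _ h0 =>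
    ⟨⟨p.1 + p.2 + 2, ?_⟩, (p.1 : ℕ)⟩) ?_ ?_ ?_ ?_
  · by_contra h1
    apply h0
    rw [hH _ _ (not_lt.mp h1)]
    ring
  · rintro ⟨b, c⟩ hp h0
    simp only [mem_sigma, mem_univ, true_and, mem_Icc]
    push_cast
    omega
  · rintro ⟨b, c⟩ hp h0 ⟨b', c'⟩ hp' h0' heq
    simp only [Sigma.mk.injEq, heq_eq_eq, Fin.mk.injEq] at heq
    simp only [Sigma.mk.injEq, heq_eq_eq, Fin.ext_iff]
    omega
  · rintro ⟨a, b⟩ hp h0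
    simp only [mem_sigma, mem_univ, true_and, mem_Icc] at hp
    have ha := a.2
    obtain ⟨b', rfl⟩ := Int.eq_ofNat_of_zero_le hp.1
    obtain ⟨c, hc⟩ := Int.eq_ofNat_of_zero_le (show 0 ≤ (a : ℕ) - 2 - (b' : ℤ) by omega)
    have hac : (a : ℕ) = b' + c + 2 := by omega
    refine ⟨⟨⟨b', by omega⟩, ⟨c, by omega⟩⟩, mem_univ _, ?_, ?_⟩
    · simp only [hc] at h0
      simp only [hac] at h0
      intro h1
      apply h0
      linear_combination h1 + H b' c * hd b' c
    · simp [Fin.ext_iff, hac]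
  · rintro ⟨b, c⟩ hp h0
    have hc : ((((b : ℕ) + c + 2 : ℕ) : ℤ)) - 2 - (b : ℕ) = (c : ℕ) := by omega
    simp only [hc]
    linear_combination (-H (b : ℕ) (c : ℕ)) * hd b c

lemma removeIdx_eq {m : ℕ} (w : Fin (m + 1) → ℝ) (i : Fin (m + 1)) :
    removeIdx w i = fun j : Fin m => w (i.succAbove j) := by
  funext j
  by_cases hj : (j : ℕ) < i
  · rw [removeIdx, if_pos hj, Fin.succAbove_of_castSucc_lt _ _ (by simpa [Fin.lt_def] using hj)]
    rfl
  · rw [removeIdx, if_neg hj,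
      Fin.succAbove_of_le_castSucc _ _ (by simpa [Fin.le_def] using not_lt.mp hj)]
    rfl

lemma sum_join_eq_Dcal {τ : ℤ → (n : ℕ) → (Fin n → ℤ) → ℝ} (h : DVVFamily τ) {g : ℤ} {m N : ℕ}
    (hN : (3 * g + (m + 1 : ℕ) - 3).toNat + 2 ≤ N) {u : ℝ} (hu : 0 < u)
    (w : Fin (m + 1) → ℝ) (hw : ∀ i, 0 < w i) (i : Fin (m + 1)) :
    ∑ k : Fin N, ∑ a : Fin (m + 1) → Fin N, (2 * ((a i : ℕ) : ℝ) + 1) *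
        ttau τ g (m + 1) (Function.update (fun j => ((a j : ℕ) : ℤ)) i ((k : ℕ) + (a i : ℕ) - 1)) *
        (∏ j, halfPow (a j) (w j)) * halfPowDeriv k u =
      u ^ (-(3 : ℝ) / 2) * Dcal u (w i) (dOmegaPoly τ g m (removeIdx w i)) := by
  rw [Dcal_dOmegaPoly h (Nat.le_of_succ_le hN), removeIdx_eq]
  have key := fun b : Fin m → Fin N => sum_join (N := N)
    (fun c => ttau τ g (m + 1) (Fin.cons c fun j => ((b j : ℕ) : ℤ)) *
      ∏ j, halfPow (b j) (w (i.succAbove j)))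
    (by
      by_contra h0
      have h1 := (ttau_ne_zero_imp h (left_ne_zero_of_mul h0)).1 0
      simp at h1)
    (by
      intro c hc
      by_contra h0
      have h1 := ttau_ne_zero_imp_lt h (a := Fin.cons c fun j => (b j : ℕ)) (by
        refine fun h2 => left_ne_zero_of_mul h0 ?_
        rw [← h2]
        congr 1
        ext j
        refine Fin.cases ?_ (fun j => ?_) j <;> simp) 0
      simp only [Fin.cons_zero] at h1
      omega)
    hu (hw i)
  have e1 : ∀ (v : Fin N) (b : Fin m → Fin N), (fun j =>
      (((i.insertNth v b : Fin (m + 1) → Fin N) j : ℕ) : ℤ)) =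
      (i.insertNth ((v : ℕ) : ℤ) (fun j => ((b j : ℕ) : ℤ)) : Fin (m + 1) → ℤ) := by
    intro v b
    ext j
    refine Fin.succAboveCases i ?_ (fun j => ?_) j <;> simp
  have e2 : ∀ k : Fin N, ∑ a : Fin (m + 1) → Fin N, (2 * ((a i : ℕ) : ℝ) + 1) *
        ttau τ g (m + 1) (Function.update (fun j => ((a j : ℕ) : ℤ)) i ((k : ℕ) + (a i : ℕ) - 1)) *
        (∏ j, halfPow (a j) (w j)) * halfPowDeriv k u =
      ∑ b : Fin m → Fin N, ∑ v : Fin N, (2 * ((v : ℕ) : ℝ) + 1) *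
        (ttau τ g (m + 1) (Fin.cons ((k : ℕ) + (v : ℕ) - 1 : ℤ) fun j => ((b j : ℕ) : ℤ)) *
          ∏ j, halfPow (b j) (w (i.succAbove j))) *
        (halfPow v (w i) * halfPowDeriv k u) := by
    intro k
    rw [sum_fin_insertNth i, Finset.sum_comm]
    refine Finset.sum_congr rfl fun b _ => Finset.sum_congr rfl fun v _ => ?_
    rw [e1, Fin.prod_univ_succAbove _ i, Fin.update_insertNth, ttau_insertNth h]
    simp only [Fin.insertNth_apply_same, Fin.insertNth_apply_succAbove]
    ring
  simp_rw [e2]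
  rw [Finset.sum_comm, Finset.sum_congr rfl fun b _ => key b, ← Finset.mul_sum, Finset.sum_comm]
  congr 1
  refine Finset.sum_congr rfl fun c _ => Finset.sum_congr rfl fun b _ => ?_
  ring

lemma sum_product_eq_deriv_mul {τ : ℤ → (n : ℕ) → (Fin n → ℤ) → ℝ} (h : DVVFamily τ)
    {g₁ g₂ : ℤ} {n N : ℕ} (A : Finset (Fin n))
    (hN₁ : (3 * g₁ + (A.card + 1 : ℕ) - 3).toNat + 1 ≤ N)
    (hN₂ : (3 * g₂ + (Aᶜ.card + 1 : ℕ) - 3).toNat + 1 ≤ N) {u : ℝ} (hu : 0 < u)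
    (w : Fin n → ℝ) :
    ∑ b : Fin N, ∑ c : Fin N, (∑ a : Fin n → Fin N,
        ttau τ g₁ (A.card + 1)
          (Fin.cons ((b : ℕ) : ℤ) fun j => ((a (A.orderIsoOfFin rfl j).1 : ℕ) : ℤ)) *
        ttau τ g₂ (Aᶜ.card + 1)
          (Fin.cons ((c : ℕ) : ℤ) fun j => ((a (Aᶜ.orderIsoOfFin rfl j).1 : ℕ) : ℤ)) *
        ∏ i, halfPow (a i) (w i)) * (halfPowDeriv b u * halfPowDeriv c u) =
      deriv (fun t => OmegaF τ g₁ (A.card + 1)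
          (Fin.cons t fun j => w (A.orderIsoOfFin rfl j).1)) u *
        deriv (fun t => OmegaF τ g₂ (Aᶜ.card + 1)
          (Fin.cons t fun j => w (Aᶜ.orderIsoOfFin rfl j).1)) u := by
  rw [deriv_OmegaF_cons h hN₁ hu, deriv_OmegaF_cons h hN₂ hu, Finset.sum_mul_sum]
  refine Finset.sum_congr rfl fun b _ => Finset.sum_congr rfl fun c _ => ?_
  rw [mul_mul_mul_comm, ← sum_fin_mul_split A]
  congr 1
  refine Finset.sum_congr rfl fun a _ => ?_
  rw [prod_split A, mul_mul_mul_comm]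

lemma sum_rotate {α β γ ι : Type*} (s : Finset α) (t : Finset β) (u : Finset γ) (v : Finset ι)
    (F : α → β → γ → ι → ℝ) :
    ∑ b ∈ s, ∑ c ∈ t, ∑ a ∈ u, ∑ i ∈ v, F b c a i =
      ∑ i ∈ v, ∑ b ∈ s, ∑ c ∈ t, ∑ a ∈ u, F b c a i := by
  rw [Finset.sum_congr rfl fun b _ => (Finset.sum_congr rfl fun c _ => Finset.sum_comm).trans
    Finset.sum_comm, Finset.sum_comm]

/-- Theorem 4.3 of the paper: assuming the DVV recursion, for `2g+n ≥ 3`,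
`∂_{w_0} Ω_{g,n+1}(w_0,w_{[n]})
  = w_0^{5/2} ∂ₓ∂_y Ω_{g-1,n+2}(x,y,w_{[n]})|_{x=y=w_0}
  + w_0^{5/2} Σˢ ∂_{w_0}Ω_{g_1,|A_1|+1}(w_0,w_{A_1}) ∂_{w_0}Ω_{g_2,|A_2|+1}(w_0,w_{A_2})
  + w_0^{-3/2} Σᵢ 𝒟_{w_0,w_i} ∂ₓ Ω_{g,n}(x, w_{[n]∖{i}})`. -/
theorem Omega_recursion (τ : ℤ → (n : ℕ) → (Fin n → ℤ) → ℝ) (h : DVVFamily τ)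
    (g n : ℕ) (h3 : 3 ≤ 2 * g + n)
    (w₀ : ℝ) (hw₀ : 0 < w₀) (w : Fin n → ℝ) (hw : ∀ i, 0 < w i) :
    deriv (fun t => OmegaF τ g (n + 1) (Fin.cons t w)) w₀ =
      w₀ ^ ((5 : ℝ) / 2) *
        deriv (fun x => deriv
          (fun y => OmegaF τ ((g : ℤ) - 1) (n + 2) (Fin.cons x (Fin.cons y w))) w₀) w₀
      + w₀ ^ ((5 : ℝ) / 2) *
          ∑ g₁ ∈ Finset.Icc (0 : ℤ) (g : ℤ), ∑ A ∈ (Finset.univ : Finset (Fin n)).powerset,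
            (if 0 < 2 * g₁ - 1 + (A.card : ℤ) ∧
                0 < 2 * ((g : ℤ) - g₁) - 1 + ((Aᶜ).card : ℤ) then
              deriv (fun t => OmegaF τ g₁ (A.card + 1)
                (Fin.cons t (fun j => w (A.orderIsoOfFin rfl j).1))) w₀
              * deriv (fun t => OmegaF τ ((g : ℤ) - g₁) ((Aᶜ).card + 1)
                  (Fin.cons t (fun j => w ((Aᶜ).orderIsoOfFin rfl j).1))) w₀
            else 0)
      + w₀ ^ (-(3 : ℝ) / 2) *
          ∑ i : Fin n, Dcal w₀ (w i) (dOmegaPoly τ g (n - 1) (removeIdx w i)) := by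
  obtain ⟨N, hN⟩ : ∃ N, N = 3 * g + n + 2 := ⟨_, rfl⟩
  set P : (Fin n → Fin N) → ℝ := fun a => ∏ i, halfPow (a i) (w i) with hP
  set T : Fin N → (Fin n → Fin N) → ℝ := fun k a => ∑ i, (2 * ((a i : ℕ) : ℝ) + 1) *
    ttau τ g n (Function.update (fun j => ((a j : ℕ) : ℤ)) i ((k : ℕ) + (a i : ℕ) - 1)) with hT
  set U : ℤ → ℤ → (Fin n → Fin N) → ℝ := fun b c a => ttau τ ((g : ℤ) - 1) (n + 2)
    (Fin.cons b (Fin.cons c fun i => ((a i : ℕ) : ℤ))) with hU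
  set V : ℤ → Finset (Fin n) → ℤ → ℤ → (Fin n → Fin N) → ℝ := fun g₁ A b c a =>
    if 0 < 2 * g₁ - 1 + (A.card : ℤ) ∧ 0 < 2 * ((g : ℤ) - g₁) - 1 + ((Aᶜ).card : ℤ) then
      ttau τ g₁ (A.card + 1)
        (Fin.cons b fun j => ((a (A.orderIsoOfFin rfl j).1 : ℕ) : ℤ)) *
      ttau τ (g - g₁) (Aᶜ.card + 1)
        (Fin.cons c fun j => ((a (Aᶜ.orderIsoOfFin rfl j).1 : ℕ) : ℤ))
    else 0 with hV
  set H : ℤ → ℤ → ℝ := fun b c => ∑ a : Fin n → Fin N,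
    (U b c a + ∑ g₁ ∈ Finset.Icc (0 : ℤ) (g : ℤ),
      ∑ A ∈ (Finset.univ : Finset (Fin n)).powerset, V g₁ A b c a) * P a with hH
  have dvv : ∀ (k : Fin N) (a : Fin n → Fin N),
      ttau τ g (n + 1) (Fin.cons ((k : ℕ) : ℤ) fun i => ((a i : ℕ) : ℤ)) =
        T k a + 1 / 2 * ∑ b ∈ Finset.Icc (0 : ℤ) ((k : ℕ) - 2),
          (U b ((k : ℕ) - 2 - b) a + ∑ g₁ ∈ Finset.Icc (0 : ℤ) (g : ℤ),
            ∑ A ∈ (Finset.univ : Finset (Fin n)).powerset, V g₁ A b ((k : ℕ) - 2 - b) a) := by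
    intro k a
    have := h.dvv g n (by positivity) (by exact_mod_cast h3) (k : ℕ) (fun i => ((a i : ℕ) : ℤ))
      (by positivity) (fun i => by positivity)
    simpa only [Int.cast_natCast] using this
  have hU0 : ∀ (b c : ℕ) (a : Fin n → Fin N), N ≤ b + c + 2 → U b c a = 0 := by
    intro b c a hbc
    by_contra h0
    obtain ⟨h1, -, h2⟩ := ttau_ne_zero_imp h h0
    have h4 : 0 ≤ ∑ i, ((a i : ℕ) : ℤ) := Finset.sum_nonneg fun i _ => by positivity
    simp only [Fin.sum_univ_succ, Fin.cons_zero, Fin.cons_succ] at h2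
    push_cast at h2
    omega
  have hcard : ∀ A : Finset (Fin n), A.card + Aᶜ.card = n := fun A => by
    simp
  have hV0 : ∀ g₁ A (b c : ℕ) (a : Fin n → Fin N), N ≤ b + c + 2 → V g₁ A b c a = 0 := by
    intro g₁ A b c a hbc
    simp only [hV, ite_eq_right_iff]
    intro _
    by_contra h0
    obtain ⟨-, -, h1⟩ := ttau_ne_zero_imp h (left_ne_zero_of_mul h0)
    obtain ⟨-, -, h2⟩ := ttau_ne_zero_imp h (right_ne_zero_of_mul h0)
    have h4 : 0 ≤ ∑ j, ((a (A.orderIsoOfFin rfl j).1 : ℕ) : ℤ) :=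
      Finset.sum_nonneg fun i _ => by positivity
    have h5 : 0 ≤ ∑ j, ((a (Aᶜ.orderIsoOfFin rfl j).1 : ℕ) : ℤ) :=
      Finset.sum_nonneg fun i _ => by positivity
    have := hcard A
    simp only [Fin.sum_univ_succ, Fin.cons_zero, Fin.cons_succ] at h1 h2
    push_cast at h1 h2
    omega
  have hH0 : ∀ b c : ℕ, N ≤ b + c + 2 → H b c = 0 := by
    intro b c hbc
    simp [hH, hU0 b c _ hbc, hV0 _ _ b c _ hbc]
  have hlhs : deriv (fun t => OmegaF τ g (n + 1) (Fin.cons t w)) w₀ =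
      (∑ k : Fin N, ∑ a, T k a * P a * halfPowDeriv k w₀) +
      ∑ k : Fin N, (1 / 2 * ∑ b ∈ Finset.Icc (0 : ℤ) ((k : ℕ) - 2), H b ((k : ℕ) - 2 - b)) *
        halfPowDeriv k w₀ := by
    rw [deriv_OmegaF_cons h (N := N) (by push_cast; omega) hw₀, ← Finset.sum_add_distrib]
    refine Finset.sum_congr rfl fun k _ => ?_
    rw [← Finset.sum_mul, ← add_mul]
    congr 1
    simp only [hH]
    rw [Finset.sum_comm, Finset.mul_sum, ← Finset.sum_add_distrib]
    refine Finset.sum_congr rfl fun a _ => ?_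
    rw [dvv, ← Finset.sum_mul]
    ring
  have hjoin : ∑ k : Fin N, ∑ a, T k a * P a * halfPowDeriv k w₀ =
      w₀ ^ (-(3 : ℝ) / 2) *
        ∑ i : Fin n, Dcal w₀ (w i) (dOmegaPoly τ g (n - 1) (removeIdx w i)) := by
    rw [Finset.mul_sum]
    have e1 : ∑ k : Fin N, ∑ a, T k a * P a * halfPowDeriv k w₀ =
        ∑ i : Fin n, ∑ k : Fin N, ∑ a : Fin n → Fin N, (2 * ((a i : ℕ) : ℝ) + 1) *
          ttau τ g n (Function.update (fun j => ((a j : ℕ) : ℤ)) i ((k : ℕ) + (a i : ℕ) - 1)) *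
          (∏ j, halfPow (a j) (w j)) * halfPowDeriv k w₀ := by
      simp only [hT, hP, Finset.sum_mul]
      rw [Finset.sum_congr rfl fun k _ => Finset.sum_comm, Finset.sum_comm]
    rw [e1]
    cases n with
    | zero => simp
    | succ m =>
      exact Finset.sum_congr rfl fun i _ =>
        sum_join_eq_Dcal h (by push_cast; omega) hw₀ w hw i
  have hsplit : ∑ b : Fin N, ∑ c : Fin N,
        H (b : ℕ) (c : ℕ) * (halfPowDeriv b w₀ * halfPowDeriv c w₀) =
      (∑ b : Fin N, ∑ c : Fin N, (∑ a, U (b : ℕ) (c : ℕ) a * P a) *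
        (halfPowDeriv b w₀ * halfPowDeriv c w₀)) +
      ∑ g₁ ∈ Finset.Icc (0 : ℤ) (g : ℤ), ∑ A ∈ (Finset.univ : Finset (Fin n)).powerset,
        ∑ b : Fin N, ∑ c : Fin N, (∑ a, V g₁ A (b : ℕ) (c : ℕ) a * P a) *
          (halfPowDeriv b w₀ * halfPowDeriv c w₀) := by
    simp only [hH, add_mul, Finset.sum_mul, Finset.sum_add_distrib]
    congr 1
    rw [sum_rotate]
    exact Finset.sum_congr rfl fun g₁ _ => sum_rotate _ _ _ _ _
  rw [hlhs, hjoin, sum_split H hH0 hw₀, hsplit, mul_add, add_comm]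
  congr 2
  · congr 1
    rw [deriv_deriv_OmegaF_cons h (N := N) (by push_cast; omega) hw₀]
    simp_rw [Finset.sum_mul]
    refine Finset.sum_congr rfl fun k _ => Finset.sum_congr rfl fun l _ =>
      Finset.sum_congr rfl fun a _ => ?_
    ring
  · congr 1
    refine Finset.sum_congr rfl fun g₁ hg₁ => Finset.sum_congr rfl fun A _ => ?_
    rw [mem_Icc] at hg₁
    have := hcard A
    split_ifs with hc
    · rw [← sum_product_eq_deriv_mul h (N := N) A (by push_cast; omega) (by push_cast; omega) hw₀]
      simp only [hV, if_pos hc, hP]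
    · simp [hV, if_neg hc]
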